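/- Let F ⊂ ℝ² be an empty integral polygon (a lattice polygon with no interior lattice points). Then after an integral affine automorphism of ℤ², F is one of: the big triangle conv{(0,0),(2,0),(0,2)}; a t-triangle conv{(0,0),(t,0),(0,1)} for some t ≥ 0; a t-trapezoid conv{(0,0),(t,0),(0,1),(1,1)} for some t ≥ 0; or a (t,s)-trapezoid conv{(0,0),(t,0),(0,1),(s,1)} for some t ≥ s > 1. -/

import Mathlib

/-- A point of `ℝ²` is a lattice point if all its coordinates are integers. -/
def IsLatticePt (x : Fin 2 → ℝ) : Prop := ∀ i, ∃ m : ℤ, x i = (m : ℝ)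

/-- The inclusion `ℤ² → ℝ²`. -/
def castPt (p : Fin 2 → ℤ) : Fin 2 → ℝ := fun i => (p i : ℝ)

/-- An affine automorphism of `ℝ²` that preserves being a lattice point. -/
def IsLatticeEquiv (T : (Fin 2 → ℝ) ≃ᵃ[ℝ] (Fin 2 → ℝ)) : Prop :=
  ∀ x, IsLatticePt x ↔ IsLatticePt (T x)

/-- A full-dimensional convex hull of finitely many lattice points without lattice points in its
interior. -/
structure IsEmptyPolygon (F : Set (Fin 2 → ℝ)) : Prop where
  exists_hull : ∃ S : Set (Fin 2 → ℝ), S.Finite ∧ (∀ x ∈ S, IsLatticePt x) ∧ F = convexHull ℝ S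
  span : affineSpan ℝ F = ⊤
  empty : ∀ x ∈ interior F, ¬ IsLatticePt x

/-- Being equivalent to one of the polygons in the classification. -/
def IsStandard (F : Set (Fin 2 → ℝ)) : Prop :=
  ∃ T : (Fin 2 → ℝ) ≃ᵃ[ℝ] (Fin 2 → ℝ), IsLatticeEquiv T ∧
    (T '' F = convexHull ℝ {![(0:ℝ),0], ![2,0], ![0,2]} ∨
     (∃ t : ℕ, T '' F = convexHull ℝ {![(0:ℝ),0], ![(t:ℝ),0], ![0,1]}) ∨
     (∃ t : ℕ, T '' F = convexHull ℝ {![(0:ℝ),0], ![(t:ℝ),0], ![0,1], ![1,1]}) ∨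
     (∃ t s : ℕ, 1 < s ∧ s ≤ t ∧
        T '' F = convexHull ℝ {![(0:ℝ),0], ![(t:ℝ),0], ![0,1], ![(s:ℝ),1]}))

theorem isLatticePt_vec (a b : ℤ) : IsLatticePt ![(a : ℝ), b] := by
  intro i
  fin_cases i
  exacts [⟨a, rfl⟩, ⟨b, rfl⟩]

theorem IsLatticePt.exists_eq_vec {x : Fin 2 → ℝ} (hx : IsLatticePt x) :
    ∃ a b : ℤ, x = ![(a : ℝ), b] := by
  obtain ⟨a, ha⟩ := hx 0
  obtain ⟨b, hb⟩ := hx 1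
  refine ⟨a, b, ?_⟩
  ext i
  fin_cases i
  exacts [ha, hb]

/-- The affine automorphism `(x, y) ↦ (a x + b y + e, c x + d y + f)` with integer coefficients and
determinant `±1`. -/
def intAffine (a b c d e f : ℤ) (h : (a * d - b * c) * (a * d - b * c) = 1) :
    (Fin 2 → ℝ) ≃ᵃ[ℝ] (Fin 2 → ℝ) where
  toFun x := ![a * x 0 + b * x 1 + e, c * x 0 + d * x 1 + f]
  invFun x := ![(a * d - b * c) * (d * (x 0 - e) - b * (x 1 - f)),
    (a * d - b * c) * (a * (x 1 - f) - c * (x 0 - e))]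
  left_inv x := by
    have h' : ((a : ℝ) * d - b * c) * (a * d - b * c) = 1 := by exact_mod_cast h
    ext i
    fin_cases i
    · simp; linear_combination (x 0) * h'
    · simp; linear_combination (x 1) * h'
  right_inv x := by
    have h' : ((a : ℝ) * d - b * c) * (a * d - b * c) = 1 := by exact_mod_cast h
    ext i
    fin_cases i
    · simp; linear_combination (x 0 - e) * h'
    · simp; linear_combination (x 1 - f) * h'
  linear :=
    { toFun := fun x => ![a * x 0 + b * x 1, c * x 0 + d * x 1]
      invFun := fun x => ![(a * d - b * c) * (d * x 0 - b * x 1),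
        (a * d - b * c) * (a * x 1 - c * x 0)]
      map_add' := fun x y => by
        ext i
        fin_cases i <;> simp <;> ring
      map_smul' := fun r x => by
        ext i
        fin_cases i <;> simp <;> ring
      left_inv := fun x => by
        have h' : ((a : ℝ) * d - b * c) * (a * d - b * c) = 1 := by exact_mod_cast h
        ext i
        fin_cases i
        · simp; linear_combination (x 0) * h'
        · simp; linear_combination (x 1) * h'
      right_inv := fun x => by
        have h' : ((a : ℝ) * d - b * c) * (a * d - b * c) = 1 := by exact_mod_cast h
        ext i
        fin_cases i
        · simp; linear_combination (x 0) * h'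
        · simp; linear_combination (x 1) * h' }
  map_vadd' x v := by
    ext i
    fin_cases i <;> simp <;> ring

theorem intAffine_apply (a b c d e f : ℤ) (h : (a * d - b * c) * (a * d - b * c) = 1)
    (x : Fin 2 → ℝ) :
    intAffine a b c d e f h x = ![a * x 0 + b * x 1 + e, c * x 0 + d * x 1 + f] := rfl

theorem intAffine_symm_apply (a b c d e f : ℤ) (h : (a * d - b * c) * (a * d - b * c) = 1)
    (x : Fin 2 → ℝ) :
    (intAffine a b c d e f h).symm x = ![(a * d - b * c) * (d * (x 0 - e) - b * (x 1 - f)),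
      (a * d - b * c) * (a * (x 1 - f) - c * (x 0 - e))] := rfl

theorem isLatticeEquiv_intAffine (a b c d e f : ℤ)
    (h : (a * d - b * c) * (a * d - b * c) = 1) : IsLatticeEquiv (intAffine a b c d e f h) := by
  intro x
  constructor
  · intro hx
    obtain ⟨p, q, rfl⟩ := hx.exists_eq_vec
    convert isLatticePt_vec (a * p + b * q + e) (c * p + d * q + f) using 1
    simp [intAffine_apply]
  · intro hx
    obtain ⟨p, q, hpq⟩ := hx.exists_eq_vec
    rw [← (intAffine a b c d e f h).symm_apply_apply x, hpq]
    convert isLatticePt_vec ((a * d - b * c) * (d * (p - e) - b * (q - f)))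
      ((a * d - b * c) * (a * (q - f) - c * (p - e))) using 1
    simp [intAffine_symm_apply]

theorem vec_mem_image_intAffine {F : Set (Fin 2 → ℝ)} {a b c d e f : ℤ}
    {h : (a * d - b * c) * (a * d - b * c) = 1} {x y p q : ℤ} (hxy : ![(x : ℝ), y] ∈ F)
    (hp : a * x + b * y + e = p) (hq : c * x + d * y + f = q) :
    ![(p : ℝ), q] ∈ intAffine a b c d e f h '' F :=
  ⟨_, hxy, by subst hp hq; simp [intAffine_apply]⟩

theorem IsStandard.of_image {F : Set (Fin 2 → ℝ)} {T : (Fin 2 → ℝ) ≃ᵃ[ℝ] (Fin 2 → ℝ)}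
    (hT : IsLatticeEquiv T) (h : IsStandard (T '' F)) : IsStandard F := by
  obtain ⟨U, hU, h⟩ := h
  refine ⟨T.trans U, fun x => (hT x).trans (hU (T x)), ?_⟩
  have : (T.trans U) '' F = U '' (T '' F) := by
    rw [Set.image_image]; rfl
  rwa [this]

theorem Convex.combination_three_mem {F : Set (Fin 2 → ℝ)} (hF : Convex ℝ F)
    {p₀ p₁ q₀ q₁ r₀ r₁ x y : ℝ} (hp : ![p₀, p₁] ∈ F) (hq : ![q₀, q₁] ∈ F) (hr : ![r₀, r₁] ∈ F)
    (α β γ : ℝ) (hα : 0 ≤ α) (hβ : 0 ≤ β) (hγ : 0 ≤ γ) (h : α + β + γ = 1)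
    (hx : α * p₀ + β * q₀ + γ * r₀ = x) (hy : α * p₁ + β * q₁ + γ * r₁ = y) : ![x, y] ∈ F := by
  have := hF.sum_mem (t := Finset.univ) (w := ![α, β, γ])
    (z := ![![p₀, p₁], ![q₀, q₁], ![r₀, r₁]])
    (by intro i _; fin_cases i <;> simpa) (by simpa [Fin.sum_univ_three])
    (by intro i _; fin_cases i <;> simpa)
  subst hx hy
  simpa [Fin.sum_univ_three] using this

namespace IsEmptyPolygon

variable {F : Set (Fin 2 → ℝ)}

protected theorem convex (hF : IsEmptyPolygon F) : Convex ℝ F := by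
  obtain ⟨S, -, -, rfl⟩ := hF.exists_hull
  exact convex_convexHull ℝ S

theorem image (hF : IsEmptyPolygon F) {T : (Fin 2 → ℝ) ≃ᵃ[ℝ] (Fin 2 → ℝ)}
    (hT : IsLatticeEquiv T) : IsEmptyPolygon (T '' F) := by
  refine ⟨?_, ?_, ?_⟩
  · obtain ⟨S, hS, hS', rfl⟩ := hF.exists_hull
    refine ⟨T '' S, hS.image _, ?_, T.toAffineMap.image_convexHull S⟩
    rintro _ ⟨x, hx, rfl⟩
    exact (hT x).1 (hS' x hx)
  · have := AffineSubspace.map_span T.toAffineMap F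
    rw [hF.span] at this
    rw [← AffineEquiv.coe_toAffineMap, ← this]
    exact AffineMap.map_top_of_surjective _ T.surjective
  · intro x hx
    have h := (AffineEquiv.toContinuousAffineEquiv T).toHomeomorph.image_interior F
    change T '' interior F = interior (T '' F) at h
    rw [← h] at hx
    obtain ⟨y, hy, rfl⟩ := hx
    exact fun h' => hF.empty y hy ((hT y).2 h')

/-- A lattice point admits a line through it having the polygon on one side. -/
theorem exists_support (hF : IsEmptyPolygon F) (p q : ℤ) :
    ∃ u v : ℝ, ¬ (u = 0 ∧ v = 0) ∧
      ∀ x y : ℝ, ![x, y] ∈ F → u * (x - p) + v * (y - q) ≤ 0 := by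
  have hne : (interior F).Nonempty :=
    hF.convex.interior_nonempty_iff_affineSpan_eq_top.2 hF.span
  obtain ⟨f, hf⟩ := geometric_hahn_banach_open_point hF.convex.interior isOpen_interior
    (fun h => hF.empty _ h (isLatticePt_vec p q))
  have key : ∀ x y : ℝ, f ![x, y] = f ![1, 0] * x + f ![0, 1] * y := by
    intro x y
    have : ![x, y] = x • ![(1:ℝ), 0] + y • ![(0:ℝ), 1] := by
      ext i
      fin_cases i <;> simp
    rw [this, map_add, map_smul, map_smul, smul_eq_mul, smul_eq_mul]
    ring
  refine ⟨f ![1, 0], f ![0, 1], ?_, ?_⟩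
  · rintro ⟨h0, h1⟩
    obtain ⟨x, hx⟩ := hne
    have h := hf x hx
    have hx' : x = ![x 0, x 1] := by
      ext i
      fin_cases i <;> rfl
    rw [hx', key, key (p : ℝ), h0, h1] at h
    simp at h
  · intro x y hxy
    have hmem : ![x, y] ∈ closure (interior F) := by
      rw [hF.convex.closure_interior_eq_closure_of_nonempty_interior hne]
      exact subset_closure hxy
    have h : f ![x, y] ≤ f ![(p : ℝ), q] :=
      closure_minimal (fun z hz => (hf z hz).le)
        (isClosed_le f.continuous continuous_const) hmem
    rw [key, key (p : ℝ)] at h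
    linarith

/-- The vertices of a full-dimensional polygon do not all lie on a horizontal line. -/
theorem exists_height_ne {S : Set (Fin 2 → ℝ)} (hS : affineSpan ℝ S = ⊤) (c : ℝ) :
    ∃ x ∈ S, x 1 ≠ c := by
  by_contra! h
  have hmem : ![(0:ℝ), c + 1] ∈ affineSpan ℝ S := by rw [hS]; trivial
  have : ![(0:ℝ), c + 1] 1 = c := by
    refine affineSpan_induction (p := fun x => x 1 = c) hmem h ?_
    intro r u v w hu hv hw
    simp [hu, hv, hw]
  simp at this

end IsEmptyPolygon

theorem isStandard_trapezoid {m₀ M₀ m₁ M₁ : ℤ} (h₀ : m₀ ≤ M₀) (h₁ : m₁ ≤ M₁) :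
    IsStandard (convexHull ℝ {![(m₀ : ℝ), 0], ![(M₀ : ℝ), 0], ![(m₁ : ℝ), 1], ![(M₁ : ℝ), 1]}) := by
  wlog hle : M₁ - m₁ ≤ M₀ - m₀ generalizing m₀ M₀ m₁ M₁
  · refine IsStandard.of_image (isLatticeEquiv_intAffine 1 0 0 (-1) 0 1 (by norm_num)) ?_
    convert this h₁ h₀ (by omega) using 1
    rw [← AffineEquiv.coe_toAffineMap, AffineMap.image_convexHull]
    congr 1
    simp only [Set.image_insert_eq, Set.image_singleton, AffineEquiv.coe_toAffineMap,
      intAffine_apply]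
    ext x
    simp
    tauto
  obtain ⟨t, ht⟩ := Int.eq_ofNat_of_zero_le (sub_nonneg.2 h₀)
  obtain ⟨s, hs⟩ := Int.eq_ofNat_of_zero_le (sub_nonneg.2 h₁)
  obtain rfl : M₀ = m₀ + t := by omega
  obtain rfl : M₁ = m₁ + s := by omega
  refine ⟨intAffine 1 (m₀ - m₁) 0 1 (-m₀) 0 (by norm_num), isLatticeEquiv_intAffine _ _ _ _ _ _ _,
    ?_⟩
  have himage : intAffine 1 (m₀ - m₁) 0 1 (-m₀) 0 (by norm_num) '' convexHull ℝ
      {![(m₀ : ℝ), 0], ![((m₀ + t : ℤ) : ℝ), 0], ![(m₁ : ℝ), 1], ![((m₁ + s : ℤ) : ℝ), 1]} =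
      convexHull ℝ {![(0:ℝ), 0], ![(t : ℝ), 0], ![0, 1], ![(s : ℝ), 1]} := by
    rw [← AffineEquiv.coe_toAffineMap, AffineMap.image_convexHull]
    congr 1
    simp only [Set.image_insert_eq, Set.image_singleton, AffineEquiv.coe_toAffineMap,
      intAffine_apply]
    have e : (m₁ : ℝ) + s + (m₀ - m₁) + -m₀ = s := by ring
    simp [e]
  rw [himage]
  have hst : s ≤ t := by omega
  rcases Nat.lt_trichotomy s 1 with hs | rfl | hs
  · obtain rfl : s = 0 := by omega
    exact Or.inr (Or.inl ⟨t, by simp⟩)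
  · exact Or.inr (Or.inr (Or.inl ⟨t, by simp⟩))
  · exact Or.inr (Or.inr (Or.inr ⟨t, s, hs, hst, rfl⟩))

/-- A finite nonempty set of lattice points on the line `y = c` has a leftmost and a rightmost
point. -/
theorem exists_extreme_of_height {S : Set (Fin 2 → ℝ)} (hfin : S.Finite)
    (hlat : ∀ x ∈ S, IsLatticePt x) {c : ℝ} (hne : ∃ x ∈ S, x 1 = c) :
    ∃ m M : ℤ, m ≤ M ∧ ![(m : ℝ), c] ∈ S ∧ ![(M : ℝ), c] ∈ S ∧
      ∀ x ∈ S, x 1 = c → (m : ℝ) ≤ x 0 ∧ x 0 ≤ M := by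
  have hfin' : {x ∈ S | x 1 = c}.Finite := hfin.subset (Set.sep_subset _ _)
  obtain ⟨p, ⟨hp, hpc⟩, hmin⟩ := Set.exists_min_image _ (fun x => x 0) hfin' hne
  obtain ⟨q, ⟨hq, hqc⟩, hmax⟩ := Set.exists_max_image _ (fun x => x 0) hfin' hne
  obtain ⟨m, b, rfl⟩ := (hlat p hp).exists_eq_vec
  obtain ⟨M, b', rfl⟩ := (hlat q hq).exists_eq_vec
  simp only [Matrix.cons_val_one, Matrix.cons_val_fin_one] at hpc hqc
  have hb : b' = b := by exact_mod_cast hqc.trans hpc.symm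
  subst hpc hb
  refine ⟨m, M, ?_, hp, hq, fun x hx hxc => ⟨hmin x ⟨hx, hxc⟩, hmax x ⟨hx, hxc⟩⟩⟩
  have := hmin _ ⟨hq, rfl⟩
  simpa using this

theorem vec_mem_convexHull_of_mem_Icc {S : Set (Fin 2 → ℝ)} {m M x c : ℝ}
    (hm : ![m, c] ∈ convexHull ℝ S) (hM : ![M, c] ∈ convexHull ℝ S) (h₁ : m ≤ x) (h₂ : x ≤ M) :
    ![x, c] ∈ convexHull ℝ S := by
  rcases eq_or_lt_of_le (h₁.trans h₂) with h | h
  · obtain rfl : x = m := by linarith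
    exact hm
  · have hpos : 0 < M - m := sub_pos.2 h
    refine (convex_convexHull ℝ S).combination_three_mem hm hM hM ((M - x) / (M - m))
      ((x - m) / (M - m)) 0 (div_nonneg (by linarith) hpos.le)
      (div_nonneg (by linarith) hpos.le) le_rfl ?_ ?_ ?_ <;> field_simp <;> ring

namespace IsEmptyPolygon

variable {F : Set (Fin 2 → ℝ)}

theorem isStandard_of_strip (hF : IsEmptyPolygon F)
    (h : ∀ a b : ℤ, ![(a : ℝ), b] ∈ F → b = 0 ∨ b = 1) : IsStandard F := by
  obtain ⟨S, hfin, hlat, rfl⟩ := hF.exists_hull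
  have hspan : affineSpan ℝ S = ⊤ := by rw [← affineSpan_convexHull]; exact hF.span
  have hstrip : ∀ x ∈ S, x 1 = 0 ∨ x 1 = 1 := by
    intro x hx
    obtain ⟨a, b, rfl⟩ := (hlat x hx).exists_eq_vec
    rcases h a b (subset_convexHull ℝ S hx) with rfl | rfl <;> simp
  obtain ⟨m₀, M₀, h₀, hm₀, hM₀, hS₀⟩ := exists_extreme_of_height hfin hlat (c := 0) <| by
    obtain ⟨x, hx, hx1⟩ := exists_height_ne hspan 1
    exact ⟨x, hx, (hstrip x hx).resolve_right hx1⟩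
  obtain ⟨m₁, M₁, h₁, hm₁, hM₁, hS₁⟩ := exists_extreme_of_height hfin hlat (c := 1) <| by
    obtain ⟨x, hx, hx1⟩ := exists_height_ne hspan 0
    exact ⟨x, hx, (hstrip x hx).resolve_left hx1⟩
  convert isStandard_trapezoid h₀ h₁ using 1
  apply subset_antisymm
  · refine convexHull_min ?_ (convex_convexHull ℝ _)
    intro x hx
    have hx' : x = ![x 0, x 1] := by
      ext i
      fin_cases i <;> rfl
    rw [hx']
    rcases hstrip x hx with hy | hy
    · rw [hy]
      exact vec_mem_convexHull_of_mem_Icc (subset_convexHull ℝ _ (by simp))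
        (subset_convexHull ℝ _ (by simp)) (hS₀ x hx hy).1 (hS₀ x hx hy).2
    · rw [hy]
      exact vec_mem_convexHull_of_mem_Icc (subset_convexHull ℝ _ (by simp))
        (subset_convexHull ℝ _ (by simp)) (hS₁ x hx hy).1 (hS₁ x hx hy).2
  · refine convexHull_mono ?_
    rintro x (rfl | rfl | rfl | rfl) <;> assumption

/-- An empty polygon containing the big triangle in its standard position, and lying above the
horizontal axis, is the big triangle. -/
theorem isStandard_of_bigTriangle_subset (hF : IsEmptyPolygon F)
    (hy : ∀ x y : ℝ, ![x, y] ∈ F → 0 ≤ y)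
    (h₀ : ![(0:ℝ), 0] ∈ F) (h₁ : ![(2:ℝ), 0] ∈ F) (h₂ : ![(0:ℝ), 2] ∈ F) : IsStandard F := by
  have hx : ∀ x y : ℝ, ![x, y] ∈ F → 0 ≤ x := by
    obtain ⟨u, v, huv, h⟩ := hF.exists_support 0 1
    have k₀ := h _ _ h₀
    have k₁ := h _ _ h₁
    have k₂ := h _ _ h₂
    norm_num at k₀ k₁ k₂
    obtain rfl : v = 0 := by linarith
    have hu : u < 0 := lt_of_le_of_ne (by linarith) (fun hu => huv ⟨hu, rfl⟩)
    intro x y hxy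
    have := h x y hxy
    norm_num at this
    nlinarith
  have hxy : ∀ x y : ℝ, ![x, y] ∈ F → x + y ≤ 2 := by
    obtain ⟨u, v, huv, h⟩ := hF.exists_support 1 1
    have k₀ := h _ _ h₀
    have k₁ := h _ _ h₁
    have k₂ := h _ _ h₂
    norm_num at k₀ k₁ k₂
    obtain rfl : u = v := by linarith
    have hu : 0 < u := lt_of_le_of_ne (by linarith) (fun hu => huv ⟨hu.symm, hu.symm⟩)
    intro x y hxy
    have := h x y hxy
    norm_num at this
    nlinarith
  refine ⟨AffineEquiv.refl ℝ _, fun _ => Iff.rfl, Or.inl ?_⟩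
  rw [AffineEquiv.coe_refl, Set.image_id]
  apply subset_antisymm
  · intro p hp
    have hp' : p = ![p 0, p 1] := by
      ext i
      fin_cases i <;> rfl
    rw [hp'] at hp ⊢
    have l₁ := hx _ _ hp
    have l₂ := hy _ _ hp
    have l₃ := hxy _ _ hp
    refine (convex_convexHull ℝ _).combination_three_mem (p₀ := 0) (p₁ := 0) (q₀ := 2) (q₁ := 0)
      (r₀ := 0) (r₁ := 2) (subset_convexHull ℝ _ (by simp)) (subset_convexHull ℝ _ (by simp))
      (subset_convexHull ℝ _ (by simp)) (1 - p 0 / 2 - p 1 / 2) (p 0 / 2) (p 1 / 2)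
      (by linarith) (by linarith) (by linarith) (by ring) (by ring) (by ring)
  · refine convexHull_min ?_ hF.convex
    rintro x (rfl | rfl | rfl) <;> assumption

/-- A lattice point at height one is not strictly inside a triangle with horizontal base. -/
theorem not_strictly_inside (hF : IsEmptyPolygon F) {t a h k : ℤ} (hh : 2 ≤ h)
    (h₀ : ![(0:ℝ), 0] ∈ F) (h₁ : ![(t:ℝ), 0] ∈ F) (h₂ : ![(a:ℝ), h] ∈ F)
    (hk : a < k * h) : a + t * (h - 1) ≤ k * h := by
  by_contra! hk'
  obtain ⟨u, v, huv, hs⟩ := hF.exists_support k 1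
  have k₀ := hs _ _ h₀
  have k₁ := hs _ _ h₁
  have k₂ := hs _ _ h₂
  have hh' : (2:ℝ) ≤ h := by exact_mod_cast hh
  have l : (a:ℝ) < k * h := by exact_mod_cast hk
  have l' : (k:ℝ) * h < a + t * (h - 1) := by exact_mod_cast hk'
  push_cast at k₀ k₁ k₂
  have e₁ : u * (a - k * h) ≤ 0 := by nlinarith
  have e₂ : u * (a + t * (h - 1) - k * h) ≤ 0 := by nlinarith
  have hu : u = 0 := by
    apply le_antisymm <;> by_contra! hc <;> nlinarith
  subst hu
  have hv : v = 0 := by nlinarith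
  exact huv ⟨rfl, hv⟩

theorem isStandard_of_long_base (hF : IsEmptyPolygon F) {t : ℤ} (ht : 2 ≤ t)
    (h₀ : ![(0:ℝ), 0] ∈ F) (h₁ : ![(t:ℝ), 0] ∈ F) : IsStandard F := by
  wlog hy : ∀ x y : ℝ, ![x, y] ∈ F → 0 ≤ y generalizing F
  · obtain ⟨u, v, huv, hs⟩ := hF.exists_support 1 0
    have k₀ := hs _ _ h₀
    have k₁ := hs _ _ h₁
    have ht' : (2:ℝ) ≤ t := by exact_mod_cast ht
    norm_num at k₀ k₁
    obtain rfl : u = 0 := by nlinarith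
    have hv : 0 < v := by
      by_contra! hv
      refine hy fun x y hxy => ?_
      have hv' : v < 0 := lt_of_le_of_ne hv (fun hv => huv ⟨rfl, hv⟩)
      have := hs x y hxy
      norm_num at this
      nlinarith
    have hT := isLatticeEquiv_intAffine 1 0 0 (-1) 0 0 (by norm_num)
    refine IsStandard.of_image hT (this (hF.image hT) ?_ ?_ ?_)
    · simpa using vec_mem_image_intAffine (p := 0) (q := 0) (x := 0) (y := 0)
        (by simpa using h₀) (by simp) (by simp)
    · simpa using vec_mem_image_intAffine (p := t) (q := 0) (x := t) (y := 0)
        (by simpa using h₁) (by simp) (by simp)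
    · rintro x y ⟨p, hp, hpe⟩
      have hp' : p = ![p 0, p 1] := by
        ext i
        fin_cases i <;> rfl
      rw [hp'] at hp
      have := hs _ _ hp
      rw [intAffine_apply] at hpe
      have h1 := congrFun hpe 1
      norm_num at h1 this
      nlinarith
  by_cases hlow : ∀ a b : ℤ, ![(a : ℝ), b] ∈ F → b = 0 ∨ b = 1
  · exact hF.isStandard_of_strip hlow
  push Not at hlow
  obtain ⟨a, h, h₂, hh0, hh1⟩ := hlow
  have hh : 2 ≤ h := by
    have : 0 ≤ h := by exact_mod_cast hy _ _ h₂
    omega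
  have hmod := Int.emod_add_mul_ediv a h
  have hlt := Int.emod_lt_of_pos a (show 0 < h by omega)
  have hnn := Int.emod_nonneg a (show h ≠ 0 by omega)
  have hk := hF.not_strictly_inside (k := a / h + 1) hh h₀ h₁ h₂ (by nlinarith)
  have hh2 : h = 2 := by nlinarith
  subst hh2
  obtain rfl : t = 2 := by nlinarith
  have ha : a = 2 * (a / 2) := by omega
  have hT := isLatticeEquiv_intAffine 1 (-(a / 2)) 0 1 0 0 (by norm_num)
  refine IsStandard.of_image hT ((hF.image hT).isStandard_of_bigTriangle_subset ?_ ?_ ?_ ?_)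
  · rintro x y ⟨p, hp, hpe⟩
    have hp' : p = ![p 0, p 1] := by
      ext i
      fin_cases i <;> rfl
    rw [hp'] at hp
    have := hy _ _ hp
    rw [intAffine_apply] at hpe
    have h1 := congrFun hpe 1
    norm_num at h1
    linarith
  · simpa using vec_mem_image_intAffine (p := 0) (q := 0) (x := 0) (y := 0)
      (by simpa using h₀) (by simp) (by simp)
  · simpa using vec_mem_image_intAffine (p := 2) (q := 0) (x := 2) (y := 0)
      (by simpa using h₁) (by simp) (by simp)
  · simpa using vec_mem_image_intAffine (p := 0) (q := 2) h₂ (by omega) (by simp)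

end IsEmptyPolygon

/-- Two distinct lattice points can be moved to the horizontal axis. -/
theorem exists_intAffine_normalize {F : Set (Fin 2 → ℝ)} {x y x' y' : ℤ} (h : ![(x:ℝ), y] ∈ F)
    (h' : ![(x':ℝ), y'] ∈ F) (hne : ¬ (x' - x = 0 ∧ y' - y = 0)) :
    ∃ T, IsLatticeEquiv T ∧ ![(0:ℝ), 0] ∈ T '' F ∧
      ![((Int.gcd (x' - x) (y' - y) : ℤ) : ℝ), 0] ∈ T '' F := by
  have hpos : 0 < Int.gcd (x' - x) (y' - y) := by
    rw [Int.gcd_pos_iff]; tauto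
  have hb := Int.gcd_eq_gcd_ab (x' - x) (y' - y)
  obtain ⟨p, hp⟩ := Int.gcd_dvd_left (x' - x) (y' - y)
  obtain ⟨q, hq⟩ := Int.gcd_dvd_right (x' - x) (y' - y)
  generalize Int.gcdA (x' - x) (y' - y) = r at hb
  generalize Int.gcdB (x' - x) (y' - y) = s at hb
  generalize Int.gcd (x' - x) (y' - y) = g at *
  have hg : (g : ℤ) ≠ 0 := by exact_mod_cast hpos.ne'
  have hdet : r * p + s * q = 1 := by
    apply mul_left_cancel₀ hg
    rw [hp, hq] at hb
    linear_combination -hb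
  refine ⟨_, isLatticeEquiv_intAffine r s (-q) p (-(r * x + s * y)) (q * x - p * y) ?_, ?_, ?_⟩
  · have : r * p - s * -q = 1 := by linear_combination hdet
    rw [this, one_mul]
  · simpa using vec_mem_image_intAffine (p := 0) (q := 0) h (by ring) (by ring)
  · simpa using vec_mem_image_intAffine (p := g) (q := 0) h'
      (by linear_combination r * hp + s * hq + g * hdet)
      (by linear_combination p * hq - q * hp)

namespace IsEmptyPolygon

variable {F : Set (Fin 2 → ℝ)}

theorem isStandard_of_two_le_gcd (hF : IsEmptyPolygon F) {x y x' y' : ℤ} (h : ![(x:ℝ), y] ∈ F)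
    (h' : ![(x':ℝ), y'] ∈ F) (hg : 2 ≤ Int.gcd (x' - x) (y' - y)) : IsStandard F := by
  obtain ⟨T, hT, h₀, h₁⟩ := exists_intAffine_normalize h h' (by
    rintro ⟨e₁, e₂⟩
    simp [e₁, e₂] at hg)
  exact IsStandard.of_image hT ((hF.image hT).isStandard_of_long_base (by omega) h₀ h₁)

theorem isStandard_of_congruent (hF : IsEmptyPolygon F) {x y x' y' : ℤ} (h : ![(x:ℝ), y] ∈ F)
    (h' : ![(x':ℝ), y'] ∈ F) (hx : 2 ∣ x' - x) (hy : 2 ∣ y' - y)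
    (hne : ¬ (x' = x ∧ y' = y)) : IsStandard F := by
  refine hF.isStandard_of_two_le_gcd h h' (Nat.le_of_dvd ?_ ?_)
  · rw [Int.gcd_pos_iff]; omega
  · exact_mod_cast Int.dvd_coe_gcd hx hy

/-- If an empty polygon contains the unimodular triangle and a lattice point in the open fourth
quadrant off the line `x + y = 1`, then it contains `(1, -1)`. -/
theorem one_neg_one_mem (hF : IsEmptyPolygon F) (h₀ : ![(0:ℝ), 0] ∈ F) (h₁ : ![(1:ℝ), 0] ∈ F)
    (h₂ : ![(0:ℝ), 1] ∈ F) {x y : ℤ} (h : ![(x:ℝ), y] ∈ F) (hx : 1 ≤ x) (hy : y ≤ -1)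
    (hne : x + y ≠ 1) : ![((1:ℤ):ℝ), ((-1:ℤ):ℝ)] ∈ F := by
  have hx' : (1:ℝ) ≤ x := by exact_mod_cast hx
  have hy' : (y:ℝ) ≤ -1 := by exact_mod_cast hy
  rcases (show x + y ≤ 0 ∨ 2 ≤ x + y by omega) with hs | hs
  · have hs' : (x:ℝ) + y ≤ 0 := by exact_mod_cast hs
    have hpos : (0:ℝ) < -y := by linarith
    have hy0 : (y:ℝ) ≠ 0 := by linarith
    refine hF.convex.combination_three_mem h₀ h₁ h ((x - 1) / -y) ((-y - x) / -y) (1 / -y)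
      (div_nonneg (by linarith) hpos.le) (div_nonneg (by linarith) hpos.le)
      (div_nonneg zero_le_one hpos.le) ?_ ?_ ?_ <;> push_cast <;> field_simp <;> ring
  · have hs' : (2:ℝ) ≤ x + y := by exact_mod_cast hs
    obtain ⟨u, v, huv, hsup⟩ := hF.exists_support 1 0
    have k₀ := hsup _ _ h₀
    have k₂ := hsup _ _ h₂
    have k₃ := hsup _ _ h
    norm_num at k₀ k₂ k₃
    have hu : u = 0 := by nlinarith
    subst hu
    exact absurd ⟨rfl, by nlinarith⟩ huv

theorem neg_one_one_mem (hF : IsEmptyPolygon F) (h₀ : ![(0:ℝ), 0] ∈ F) (h₁ : ![(1:ℝ), 0] ∈ F)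
    (h₂ : ![(0:ℝ), 1] ∈ F) {x y : ℤ} (h : ![(x:ℝ), y] ∈ F) (hx : x ≤ -1) (hy : 1 ≤ y)
    (hne : x + y ≠ 1) : ![((-1:ℤ):ℝ), ((1:ℤ):ℝ)] ∈ F := by
  have hT := isLatticeEquiv_intAffine 0 1 1 0 0 0 (by norm_num)
  obtain ⟨p, hp, hpe⟩ : ![((1:ℤ):ℝ), ((-1:ℤ):ℝ)] ∈ intAffine 0 1 1 0 0 0 (by norm_num) '' F := by
    refine (hF.image hT).one_neg_one_mem (x := y) (y := x) ?_ ?_ ?_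
      (vec_mem_image_intAffine h (by ring) (by ring)) hy hx (by omega)
    · simpa using vec_mem_image_intAffine (p := 0) (q := 0) (x := 0) (y := 0)
        (by simpa using h₀) (by simp) (by simp)
    · simpa using vec_mem_image_intAffine (p := 1) (q := 0) (x := 0) (y := 1)
        (by simpa using h₂) (by simp) (by simp)
    · simpa using vec_mem_image_intAffine (p := 0) (q := 1) (x := 1) (y := 0)
        (by simpa using h₁) (by simp) (by simp)
  rw [intAffine_apply] at hpe
  convert hp using 1
  have e₀ := congrFun hpe 0
  have e₁ := congrFun hpe 1
  norm_num at e₀ e₁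
  ext i
  fin_cases i <;> simp [e₀, e₁]

theorem isStandard_of_unimodular_triangle (hF : IsEmptyPolygon F) (h₀ : ![(0:ℝ), 0] ∈ F)
    (h₁ : ![(1:ℝ), 0] ∈ F) (h₂ : ![(0:ℝ), 1] ∈ F) : IsStandard F := by
  by_contra hns
  have huniq : ∀ x y x' y' : ℤ, ![(x:ℝ), y] ∈ F → ![(x':ℝ), y'] ∈ F → 2 ∣ x' - x → 2 ∣ y' - y →
      x' = x ∧ y' = y := by
    intro x y x' y' h h' hx hy
    by_contra hne
    exact hns (hF.isStandard_of_congruent h h' hx hy hne)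
  have hodd : ∀ x y : ℤ, ![(x:ℝ), y] ∈ F → (x = 0 ∧ y = 0) ∨ (x = 1 ∧ y = 0) ∨ (x = 0 ∧ y = 1) ∨
      (x = 1 ∧ y = 1) ∨ (x = 1 ∧ y = -1) ∨ (x = -1 ∧ y = 1) := by
    intro x y h
    rcases Int.emod_two_eq_zero_or_one x with hx | hx <;>
      rcases Int.emod_two_eq_zero_or_one y with hy | hy
    · exact Or.inl (huniq 0 0 x y (by simpa using h₀) h (by omega) (by omega))
    · exact Or.inr (Or.inr (Or.inl (huniq 0 1 x y (by simpa using h₂) h (by omega) (by omega))))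
    · exact Or.inr (Or.inl (huniq 1 0 x y (by simpa using h₁) h (by omega) (by omega)))
    rcases (show x ≤ -1 ∨ 1 ≤ x by omega) with lx | lx <;>
      rcases (show y ≤ -1 ∨ 1 ≤ y by omega) with ly | ly
    · have lx' : (x:ℝ) ≤ -1 := by exact_mod_cast lx
      have ly' : (y:ℝ) ≤ -1 := by exact_mod_cast ly
      obtain ⟨u, v, huv, hs⟩ := hF.exists_support 0 0
      have k₁ := hs _ _ h₁
      have k₂ := hs _ _ h₂
      have k₃ := hs _ _ h
      norm_num at k₁ k₂ k₃
      exact absurd ⟨by nlinarith, by nlinarith⟩ huv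
    · have := huniq (-1) 1 x y (hF.neg_one_one_mem h₀ h₁ h₂ h lx ly (by omega)) h
        (by omega) (by omega)
      omega
    · have := huniq 1 (-1) x y (hF.one_neg_one_mem h₀ h₁ h₂ h lx ly (by omega)) h
        (by omega) (by omega)
      omega
    · have lx' : (1:ℝ) ≤ x := by exact_mod_cast lx
      have ly' : (1:ℝ) ≤ y := by exact_mod_cast ly
      have hpos : (0:ℝ) < x + y - 1 := by linarith
      have := huniq 1 1 x y (hF.convex.combination_three_mem h₁ h₂ h ((y - 1) / (x + y - 1))
        ((x - 1) / (x + y - 1)) (1 / (x + y - 1)) (div_nonneg (by linarith) hpos.le)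
        (div_nonneg (by linarith) hpos.le) (div_nonneg zero_le_one hpos.le)
        (by field_simp; ring) (by push_cast; field_simp; ring) (by push_cast; field_simp; ring)) h
        (by omega) (by omega)
      omega
  by_cases hq : ![((1:ℤ):ℝ), ((-1:ℤ):ℝ)] ∈ F
  · have hT := isLatticeEquiv_intAffine 0 1 1 0 0 0 (by norm_num)
    refine hns (IsStandard.of_image hT ((hF.image hT).isStandard_of_strip ?_))
    rintro a b ⟨p, hp, hpe⟩
    have hp' : p = ![(b:ℝ), a] := by
      rw [intAffine_apply] at hpe
      have e₀ := congrFun hpe 0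
      have e₁ := congrFun hpe 1
      norm_num at e₀ e₁
      ext i
      fin_cases i <;> simp [e₀, e₁]
    rw [hp'] at hp
    have := huniq _ _ _ _ hq hp
    have := hodd _ _ hp
    omega
  · refine hns (hF.isStandard_of_strip fun a b h => ?_)
    rcases hodd a b h with h' | h' | h' | h' | ⟨rfl, rfl⟩ | h'
    all_goals first | exact absurd h hq | omega

theorem isStandard_of_unit_base (hF : IsEmptyPolygon F) (h₀ : ![(0:ℝ), 0] ∈ F)
    (h₁ : ![(1:ℝ), 0] ∈ F) : IsStandard F := by
  obtain ⟨a, h, h₂, hh⟩ : ∃ a h : ℤ, ![(a:ℝ), h] ∈ F ∧ h ≠ 0 := by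
    obtain ⟨S, hfin, hlat, rfl⟩ := hF.exists_hull
    obtain ⟨x, hx, hx0⟩ := exists_height_ne (S := S)
      (by rw [← affineSpan_convexHull]; exact hF.span) 0
    obtain ⟨a, b, rfl⟩ := (hlat x hx).exists_eq_vec
    exact ⟨a, b, subset_convexHull ℝ S hx, by simpa using hx0⟩
  wlog hpos : 0 < h generalizing F h
  · have hT := isLatticeEquiv_intAffine 1 0 0 (-1) 0 0 (by norm_num)
    refine IsStandard.of_image hT (this (hF.image hT) ?_ ?_ (-h) ?_ (by omega) (by omega))
    · simpa using vec_mem_image_intAffine (p := 0) (q := 0) (x := 0) (y := 0)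
        (by simpa using h₀) (by simp) (by simp)
    · simpa using vec_mem_image_intAffine (p := 1) (q := 0) (x := 1) (y := 0)
        (by simpa using h₁) (by simp) (by simp)
    · exact vec_mem_image_intAffine h₂ (by ring) (by ring)
  have hmod := Int.emod_add_mul_ediv a h
  have hlt := Int.emod_lt_of_pos a hpos
  have hnn := Int.emod_nonneg a hh
  have hT := isLatticeEquiv_intAffine 1 (-(a / h)) 0 1 0 0 (by norm_num)
  refine IsStandard.of_image hT ?_
  replace hF := hF.image hT
  replace h₀ := vec_mem_image_intAffine (h := by norm_num) (a := 1) (b := -(a / h)) (c := 0)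
    (d := 1) (e := 0) (f := 0) (p := 0) (q := 0) (x := 0) (y := 0)
    (by simpa using h₀) (by simp) (by simp)
  replace h₁ := vec_mem_image_intAffine (h := by norm_num) (a := 1) (b := -(a / h)) (c := 0)
    (d := 1) (e := 0) (f := 0) (p := 1) (q := 0) (x := 1) (y := 0)
    (by simpa using h₁) (by simp) (by simp)
  replace h₂ := vec_mem_image_intAffine (h := by norm_num) (a := 1) (b := -(a / h)) (c := 0)
    (d := 1) (e := 0) (f := 0) (p := a % h) (q := h) h₂ (by linarith) (by ring)
  generalize intAffine 1 (-(a / h)) 0 1 0 0 _ '' F = G at *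
  generalize a % h = r at *
  rcases hnn.eq_or_lt with rfl | hr
  · rcases (show 1 ≤ h from hpos).eq_or_lt with rfl | hh2
    · exact hF.isStandard_of_unimodular_triangle (by simpa using h₀) (by simpa using h₁)
        (by simpa using h₂)
    · refine hF.isStandard_of_two_le_gcd h₀ h₂ ?_
      simp only [sub_zero, Int.gcd_zero_left]
      omega
  · have hpos' : (0:ℝ) < h := by exact_mod_cast hpos
    have hr' : (1:ℝ) ≤ r := by exact_mod_cast hr
    have hlt' : (r:ℝ) ≤ h := by exact_mod_cast hlt.le
    have h₃ : ![((1:ℤ):ℝ), ((1:ℤ):ℝ)] ∈ G := by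
      refine hF.convex.combination_three_mem h₀ h₁ h₂ ((r - 1) / h) ((h - r) / h) (1 / h)
        (div_nonneg (by linarith) hpos'.le) (div_nonneg (by linarith) hpos'.le)
        (div_nonneg zero_le_one hpos'.le) ?_ ?_ ?_ <;> push_cast <;> field_simp <;> ring
    have hT := isLatticeEquiv_intAffine 1 (-1) 0 1 0 0 (by norm_num)
    refine IsStandard.of_image hT ((hF.image hT).isStandard_of_unimodular_triangle ?_ ?_ ?_)
    · simpa using vec_mem_image_intAffine (p := 0) (q := 0) h₀ (by simp) (by simp)
    · simpa using vec_mem_image_intAffine (p := 1) (q := 0) h₁ (by simp) (by simp)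
    · simpa using vec_mem_image_intAffine (p := 0) (q := 1) h₃ (by simp) (by simp)

protected theorem isStandard (hF : IsEmptyPolygon F) : IsStandard F := by
  obtain ⟨x, y, x', y', h, h', hne⟩ : ∃ x y x' y' : ℤ, ![(x:ℝ), y] ∈ F ∧ ![(x':ℝ), y'] ∈ F ∧
      y' ≠ y := by
    obtain ⟨S, hfin, hlat, rfl⟩ := hF.exists_hull
    have hspan : affineSpan ℝ S = ⊤ := by rw [← affineSpan_convexHull]; exact hF.span
    obtain ⟨p, hp, -⟩ := exists_height_ne hspan 0
    obtain ⟨q, hq, hqp⟩ := exists_height_ne hspan (p 1)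
    obtain ⟨a, b, rfl⟩ := (hlat p hp).exists_eq_vec
    obtain ⟨a', b', rfl⟩ := (hlat q hq).exists_eq_vec
    exact ⟨a, b, a', b', subset_convexHull ℝ S hp, subset_convexHull ℝ S hq, by simpa using hqp⟩
  by_cases hg : 2 ≤ Int.gcd (x' - x) (y' - y)
  · exact hF.isStandard_of_two_le_gcd h h' hg
  · have hpos : 0 < Int.gcd (x' - x) (y' - y) := by rw [Int.gcd_pos_iff]; omega
    obtain ⟨T, hT, h₀, h₁⟩ := exists_intAffine_normalize h h' (by omega)
    rw [show Int.gcd (x' - x) (y' - y) = 1 by omega] at h₁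
    exact IsStandard.of_image hT ((hF.image hT).isStandard_of_unit_base h₀ (by simpa using h₁))

end IsEmptyPolygon

/-- Classification of empty integral polygons: an integral polygon (convex hull of a finite
set of lattice points spanning `ℝ²` affinely) with no lattice point in its interior is,
after an integral affine automorphism of `ℝ²`, a big triangle, a `t`-triangle, a
`t`-trapezoid, or a `(t,s)`-trapezoid with `t ≥ s > 1`. -/
theorem stmt6 (S : Finset (Fin 2 → ℤ)) (F : Set (Fin 2 → ℝ))
    (hF : F = convexHull ℝ (castPt '' (S : Set (Fin 2 → ℤ))))
    (hspan : affineSpan ℝ F = ⊤)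
    (hempty : ∀ x ∈ interior F, ¬ IsLatticePt x) :
    ∃ T : (Fin 2 → ℝ) ≃ᵃ[ℝ] (Fin 2 → ℝ),
      (∀ x, IsLatticePt x ↔ IsLatticePt (T x)) ∧
      (T '' F = convexHull ℝ {![(0:ℝ),0], ![2,0], ![0,2]} ∨
       (∃ t : ℕ, T '' F = convexHull ℝ {![(0:ℝ),0], ![(t:ℝ),0], ![0,1]}) ∨
       (∃ t : ℕ, T '' F = convexHull ℝ {![(0:ℝ),0], ![(t:ℝ),0], ![0,1], ![1,1]}) ∨
       (∃ t s : ℕ, 1 < s ∧ s ≤ t ∧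
          T '' F = convexHull ℝ {![(0:ℝ),0], ![(t:ℝ),0], ![0,1], ![(s:ℝ),1]})) := by
  refine IsEmptyPolygon.isStandard ⟨⟨castPt '' S, S.finite_toSet.image _, ?_, hF⟩, hspan, hempty⟩
  rintro _ ⟨p, -, rfl⟩ i
  exact ⟨p i, rfl⟩
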